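/- For every NDPM M (with p pointers) and every set S of binary words decided by M, there exists an acyclic NDPM M' (possibly with more pointers and more states) that decides S. (Acyclic means: for every pseudo-configuration c' of M' and every input word w, every branch of M'_{c'}(w) is finite.) -/

import Mathlib

/-- A pointer instruction: move one step forward, one step backward, or stay. -/
inductive Move : Type
  | forward
  | backward
  | stay
deriving DecidableEq

/-- A non-deterministic pointer machine (NDPM) with `p` pointers: a finite set `Q` of
states together with a transition relation from pseudo-configurations (the last values
read by the `p` pointers — `none` denoting `⋆` — and the current state) to either a
tuple of instructions and a new state (`Sum.inl`), or `accept` (`Sum.inr true`) /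
`reject` (`Sum.inr false`). -/
structure NDPM (p : ℕ) : Type 1 where
  Q : Type
  finQ : Fintype Q
  trans : ((Fin p → Option Bool) × Q) → (((Fin p → Move) × Q) ⊕ Bool) → Prop

/-- A configuration of an NDPM with `p` pointers and state set `Q`: the `p` pointer
positions, the `p` stored values (`none` = `⋆`), and the current state. -/
structure PConfig (p : ℕ) (Q : Type) : Type where
  pos : Fin p → ℕ
  val : Fin p → Option Bool
  state : Q

/-- The symbol held at position `pos` of the circular tape `⋆a₁…a_k` for the input
word `w = a₁…a_k` (positions are taken modulo `k+1`; position `0` holds `⋆ = none`). -/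
def tapeSym (w : List Bool) (pos : ℕ) : Option Bool :=
  if pos % (w.length + 1) = 0 then none else w[(pos % (w.length + 1)) - 1]?

/-- The new position after applying an instruction, on a circular tape of length `k+1`. -/
def movePos (k : ℕ) (pos : ℕ) : Move → ℕ
  | Move.forward => (pos + 1) % (k + 1)
  | Move.backward => (pos + k) % (k + 1)
  | Move.stay => pos

/-- One (non-terminal) computation step of the machine `M` on input word `w`: some
transition applies to the pseudo-configuration of `c`, each pointer moves according
to its instruction, and the stored value of each pointer that moved is updated to the
symbol at its new position. -/
def NDPM.Step {p : ℕ} (M : NDPM p) (w : List Bool) (c c' : PConfig p M.Q) : Prop :=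
  ∃ (mv : Fin p → Move) (q' : M.Q),
    M.trans (c.val, c.state) (Sum.inl (mv, q')) ∧
    c'.state = q' ∧
    (∀ i, c'.pos i = movePos w.length (c.pos i) (mv i)) ∧
    (∀ i, c'.val i =
      if mv i = Move.stay then c.val i
      else tapeSym w (movePos w.length (c.pos i) (mv i)))

/-- The initial configuration of `M_c(w)`: all pointers at position `0`, stored values
and state given by the pseudo-configuration `c`. -/
def NDPM.initConfig {p : ℕ} (M : NDPM p) (c : (Fin p → Option Bool) × M.Q) :
    PConfig p M.Q :=
  ⟨fun _ => 0, c.1, c.2⟩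

/-- `M_c(w)` has an infinite branch: an infinite sequence of configurations starting at
the initial configuration, each related to the next by a computation step. -/
def NDPM.InfiniteBranch {p : ℕ} (M : NDPM p) (c : (Fin p → Option Bool) × M.Q)
    (w : List Bool) : Prop :=
  ∃ f : ℕ → PConfig p M.Q, f 0 = M.initConfig c ∧ ∀ n, M.Step w (f n) (f (n + 1))

/-- `M_c(w)` rejects: some branch reaches a configuration from which a transition to
`reject` applies. -/
def NDPM.Rejects {p : ℕ} (M : NDPM p) (c : (Fin p → Option Bool) × M.Q)
    (w : List Bool) : Prop :=
  ∃ d : PConfig p M.Q, Relation.ReflTransGen (M.Step w) (M.initConfig c) d ∧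
    M.trans (d.val, d.state) (Sum.inr false)

/-- `M_c(w)` accepts: every maximal branch is finite and ends in `accept`, i.e. there
is no infinite branch and no branch ever reaches a transition to `reject` (recall that
a branch to which no transition applies ends in `accept` by default). -/
def NDPM.Accepts {p : ℕ} (M : NDPM p) (c : (Fin p → Option Bool) × M.Q)
    (w : List Bool) : Prop :=
  ¬ M.InfiniteBranch c w ∧ ¬ M.Rejects c w

/-- `M` decides the set `S` of binary words: for some pseudo-configuration `c`,
`M_c(w)` accepts exactly the words `w ∈ S`. -/
def NDPM.Decides {p : ℕ} (M : NDPM p) (S : Set (List Bool)) : Prop :=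
  ∃ c : (Fin p → Option Bool) × M.Q, ∀ w : List Bool, M.Accepts c w ↔ w ∈ S

/-- `M` is acyclic: for every pseudo-configuration and every input word, every branch
of the computation tree is finite. -/
def NDPM.Acyclic {p : ℕ} (M : NDPM p) : Prop :=
  ∀ (c : (Fin p → Option Bool) × M.Q) (w : List Bool), ¬ M.InfiniteBranch c w

/-- The odometer decrement lemma: decrementing a base `k+1` number digit by digit. -/
theorem odo_tick (k : ℕ) : ∀ (m : ℕ) (d d' : Fin m → ℕ)
    (_ : ∀ j, (∀ i, i < j → d i = 0) → d j = 0 → d' j = k)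
    (_ : ∀ j, (∀ i, i < j → d i = 0) → d j ≠ 0 → d' j + 1 = d j)
    (_ : ∀ j, ¬ (∀ i, i < j → d i = 0) → d' j = d j),
    ((∀ j, d j = 0) → ∑ j, d' j * (k + 1) ^ (j : ℕ) + 1 =
      ∑ j, d j * (k + 1) ^ (j : ℕ) + (k + 1) ^ m) ∧
    ((¬ ∀ j, d j = 0) → ∑ j, d' j * (k + 1) ^ (j : ℕ) + 1 =
      ∑ j, d j * (k + 1) ^ (j : ℕ)) := by
  intro m
  induction m with
  | zero => intro d d' _ _ _; simp
  | succ m ih =>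
    intro d d' h1 h2 h3
    have key : ∀ j : Fin m, (∀ i, i < j.castSucc → d i = 0) ↔
        (∀ i : Fin m, i < j → d i.castSucc = 0) := by
      intro j
      constructor
      · intro h i hi
        exact h _ (by simpa using hi)
      · intro h i hi
        have hlt : (i : ℕ) < m := lt_trans (Fin.lt_def.1 hi) j.2
        exact h ⟨i, hlt⟩ (Fin.lt_def.2 (Fin.lt_def.1 hi))
    have keyl : (∀ i, i < Fin.last m → d i = 0) ↔ (∀ i : Fin m, d i.castSucc = 0) := by
      constructor
      · intro h i
        exact h _ (Fin.castSucc_lt_last i)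
      · intro h i hi
        exact h ⟨i, Fin.lt_def.1 hi⟩
    have ih' := ih (fun j => d j.castSucc) (fun j => d' j.castSucc)
      (fun j h => h1 _ ((key j).2 h)) (fun j h => h2 _ ((key j).2 h))
      (fun j h => h3 _ (fun h' => h ((key j).1 h')))
    have hall : (∀ j, d j = 0) ↔ (∀ j : Fin m, d j.castSucc = 0) ∧ d (Fin.last m) = 0 :=
      Fin.forall_fin_succ' 
    rw [hall, Fin.sum_univ_castSucc, Fin.sum_univ_castSucc]
    simp only [Fin.val_castSucc, Fin.val_last]
    have l1 := h1 (Fin.last m)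
    have l2 := h2 (Fin.last m)
    have l3 := h3 (Fin.last m)
    rw [keyl] at l1 l2 l3
    obtain ⟨i1, i2⟩ := ih'
    constructor
    · rintro ⟨ha, hb⟩
      have := i1 ha
      rw [l1 ha hb, hb, pow_succ]
      linarith
    · intro hn
      by_cases ha : ∀ j : Fin m, d j.castSucc = 0
      · have hb : d (Fin.last m) ≠ 0 := fun hb => hn ⟨ha, hb⟩
        have := i1 ha
        rw [← l2 ha hb]
        linarith
      · have := i2 ha
        rw [l3 ha]
        linarith

/-- The clocked version of `M`: `p` additional clock pointers and a finite counter. -/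
def NDPM.clocked {p : ℕ} (M : NDPM p) (K : ℕ) : NDPM (p + p) where
  Q := M.Q × Fin (K + 1)
  finQ := letI := M.finQ; inferInstance
  trans := fun a b => match b with
    | Sum.inl (mv, q') =>
        M.trans (fun i => a.1 (Fin.castAdd p i), a.2.1)
          (Sum.inl (fun i => mv (Fin.castAdd p i), q'.1)) ∧
        (∀ j : Fin p, (∀ i, i < j → a.1 (Fin.natAdd p i) = none) →
          mv (Fin.natAdd p j) = Move.backward) ∧
        (∀ j : Fin p, (¬ ∀ i, i < j → a.1 (Fin.natAdd p i) = none) →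
          mv (Fin.natAdd p j) = Move.stay) ∧
        ((∀ j : Fin p, a.1 (Fin.natAdd p j) = none) → (q'.2 : ℕ) + 1 = a.2.2) ∧
        ((¬ ∀ j : Fin p, a.1 (Fin.natAdd p j) = none) → q'.2 = a.2.2)
    | Sum.inr true => False
    | Sum.inr false =>
        M.trans (fun i => a.1 (Fin.castAdd p i), a.2.1) (Sum.inr false) ∨
        ((a.2.2 : ℕ) = 0 ∧ ∀ j : Fin p, a.1 (Fin.natAdd p j) = none)

/-- Projection of a configuration of the clocked machine. -/
def projC {p : ℕ} {Q : Type} {K : ℕ} (c : PConfig (p + p) (Q × Fin (K + 1))) : PConfig p Q :=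
  ⟨fun i => c.pos (Fin.castAdd p i), fun i => c.val (Fin.castAdd p i), c.state.1⟩

/-- The effective digit of a clock pointer. -/
def digC (k : ℕ) (pos : ℕ) (v : Option Bool) : ℕ :=
  if v = none then 0 else if pos = 0 then k + 1 else pos

/-- Remaining time on the clock. -/
def timeC {p : ℕ} {Q : Type} {K : ℕ} (k : ℕ) (c : PConfig (p + p) (Q × Fin (K + 1))) : ℕ :=
  ∑ j : Fin p, digC k (c.pos (Fin.natAdd p j)) (c.val (Fin.natAdd p j)) * (k + 1) ^ (j : ℕ)
    + (c.state.2 : ℕ) * (k + 1) ^ p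

/-- Invariant. -/
def invC {p : ℕ} {Q : Type} {K : ℕ} (k : ℕ) (c : PConfig (p + p) (Q × Fin (K + 1))) : Prop :=
  ∀ j : Fin p, c.pos (Fin.natAdd p j) ≤ k ∧
    (c.val (Fin.natAdd p j) = none → c.pos (Fin.natAdd p j) = 0)

theorem digC_eq_zero (k pos : ℕ) (v : Option Bool) : digC k pos v = 0 ↔ v = none := by
  unfold digC; split_ifs <;> simp_all

theorem tapeSym_none (w : List Bool) (x : ℕ) (hx : x ≤ w.length) :
    tapeSym w x = none ↔ x = 0 := by
  unfold tapeSym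
  rw [Nat.mod_eq_of_lt (by omega)]
  split_ifs with h
  · simp [h]
  · simp [h]; omega

theorem back_le (k x : ℕ) : movePos k x Move.backward ≤ k :=
  Nat.le_of_lt_succ (Nat.mod_lt _ (Nat.succ_pos k))

theorem back_zero (k : ℕ) : movePos k 0 Move.backward = k := by
  simp [movePos]

theorem back_pos (k x : ℕ) (h : x ≠ 0) (hx : x ≤ k) : movePos k x Move.backward = x - 1 := by
  simp only [movePos]
  rw [show x + k = (x - 1) + (k + 1) by omega, Nat.add_mod_right, Nat.mod_eq_of_lt (by omega)]

theorem digC_consistent (w : List Bool) (x : ℕ) (hx : x ≤ w.length) :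
    digC w.length x (tapeSym w x) = x := by
  unfold digC
  simp only [tapeSym_none w x hx]
  split_ifs <;> simp_all

theorem step_inv {p : ℕ} (M : NDPM p) (K : ℕ) (w : List Bool)
    (c c' : PConfig (p + p) (M.Q × Fin (K + 1)))
    (hs : (M.clocked K).Step w c c') (hi : invC w.length c) :
    M.Step w (projC c) (projC c') ∧ invC w.length c' ∧
      timeC w.length c' + 1 = timeC w.length c := by
  obtain ⟨mv, q', ht, hq, hpos, hval⟩ := hs
  obtain ⟨t1, t2, t3, t4, t5⟩ := ht
  simp only at t1 t2 t3 t4 t5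
  have hb : ∀ j : Fin p, (∀ i, i < j → c.val (Fin.natAdd p i) = none) →
      c'.pos (Fin.natAdd p j) = movePos w.length (c.pos (Fin.natAdd p j)) Move.backward ∧
      c'.val (Fin.natAdd p j) = tapeSym w (c'.pos (Fin.natAdd p j)) := by
    intro j hj
    rw [hpos, hval, t2 j hj]
    simp
  have hst : ∀ j : Fin p, (¬ ∀ i, i < j → c.val (Fin.natAdd p i) = none) →
      c'.pos (Fin.natAdd p j) = c.pos (Fin.natAdd p j) ∧
      c'.val (Fin.natAdd p j) = c.val (Fin.natAdd p j) := by
    intro j hj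
    rw [hpos, hval, t3 j hj]
    simp [movePos]
  refine ⟨⟨_, _, t1, ?_, fun i => hpos _, fun i => hval _⟩, ?_, ?_⟩
  · simp [projC, hq]
  · intro j
    by_cases hj : ∀ i, i < j → c.val (Fin.natAdd p i) = none
    · obtain ⟨a, b⟩ := hb j hj
      have hle : c'.pos (Fin.natAdd p j) ≤ w.length := by rw [a]; exact back_le _ _
      refine ⟨hle, ?_⟩
      rw [b, tapeSym_none w _ hle]
      exact id
    · obtain ⟨a, b⟩ := hst j hj
      rw [a, b]
      exact hi j
  · have := odo_tick w.length p
      (fun j => digC w.length (c.pos (Fin.natAdd p j)) (c.val (Fin.natAdd p j)))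
      (fun j => digC w.length (c'.pos (Fin.natAdd p j)) (c'.val (Fin.natAdd p j)))
      ?_ ?_ ?_
    · simp only [digC_eq_zero] at this
      unfold timeC
      by_cases hz : ∀ j : Fin p, c.val (Fin.natAdd p j) = none
      · have e1 := this.1 hz
        have e2 := t4 hz
        rw [hq, ← e2]
        linarith
      · have e1 := this.2 hz
        have e2 := t5 hz
        rw [hq, e2]
        linarith
    · simp only [digC_eq_zero]
      intro j hj h0
      obtain ⟨a, b⟩ := hb j hj
      rw [(hi j).2 h0, back_zero] at a
      rw [b, a, digC_consistent _ _ le_rfl]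
    · simp only [digC_eq_zero, ne_eq]
      intro j hj h0
      obtain ⟨a, b⟩ := hb j hj
      rw [b, digC_consistent _ _ (by rw [a]; exact back_le _ _), a]
      unfold digC
      rw [if_neg h0]
      split_ifs with h
      · rw [h, back_zero]
      · rw [back_pos _ _ h (hi j).1]; omega
    · simp only [digC_eq_zero]
      intro j hj
      obtain ⟨a, b⟩ := hst j hj
      rw [a, b]

theorem init_inv {p : ℕ} (M : NDPM p) (K k : ℕ) (c) : invC k ((M.clocked K).initConfig c) := by
  intro j
  simp [NDPM.initConfig]

theorem clocked_acyclic {p : ℕ} (M : NDPM p) (K : ℕ) : (M.clocked K).Acyclic := by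
  rintro c w ⟨f, h0, hf⟩
  have H : ∀ n, invC w.length (f n) ∧ timeC w.length (f n) + n = timeC w.length (f 0) := by
    intro n
    induction n with
    | zero => exact ⟨h0 ▸ init_inv M K _ c, rfl⟩
    | succ n ih =>
      obtain ⟨-, a, b⟩ := step_inv M K w _ _ (hf n) ih.1
      exact ⟨a, by omega⟩
  have := (H (timeC w.length (f 0) + 1)).2
  omega

/-- If the clock has not run out, a step of `M` lifts to the clocked machine. -/
theorem lift_step {p : ℕ} (M : NDPM p) (K : ℕ) (w : List Bool)
    (c : PConfig (p + p) (M.Q × Fin (K + 1))) (d : PConfig p M.Q)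
    (hs : M.Step w (projC c) d) :
    ((M.clocked K).trans (c.val, c.state) (Sum.inr false)) ∨
    ∃ c', (M.clocked K).Step w c c' ∧ projC c' = d := by
  classical
  obtain ⟨mv, q', ht, hq, hpos, hval⟩ := hs
  by_cases hz : ((c.state.2 : ℕ) = 0 ∧ ∀ j : Fin p, c.val (Fin.natAdd p j) = none)
  · left; exact Or.inr hz
  right
  obtain ⟨t', ht4, ht5⟩ : ∃ t' : Fin (K + 1),
      ((∀ j : Fin p, c.val (Fin.natAdd p j) = none) → (t' : ℕ) + 1 = c.state.2) ∧
      ((¬ ∀ j : Fin p, c.val (Fin.natAdd p j) = none) → t' = c.state.2) := by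
    by_cases ha : ∀ j : Fin p, c.val (Fin.natAdd p j) = none
    · have h0 : (c.state.2 : ℕ) ≠ 0 := fun h => hz ⟨h, ha⟩
      have h1 := c.state.2.2
      exact ⟨⟨c.state.2 - 1, by omega⟩, fun _ => by simp only []; omega, fun h => absurd ha h⟩
    · exact ⟨c.state.2, fun h => absurd h ha, fun _ => rfl⟩
  let mv' : Fin (p + p) → Move := Fin.append mv
    (fun j => if ∀ i, i < j → c.val (Fin.natAdd p i) = none then Move.backward else Move.stay)
  refine ⟨⟨fun i => movePos w.length (c.pos i) (mv' i), fun i =>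
    if mv' i = Move.stay then c.val i else tapeSym w (movePos w.length (c.pos i) (mv' i)),
    (q', t')⟩, ⟨mv', (q', t'), ⟨?_, ?_, ?_, ht4, ht5⟩, rfl, fun _ => rfl, fun _ => rfl⟩, ?_⟩
  · simpa [mv', projC] using ht
  · intro j hj
    simp only [mv', Fin.append_right]
    exact if_pos hj
  · intro j hj
    simp only [mv', Fin.append_right]
    exact if_neg hj
  · obtain ⟨dp, dv, ds⟩ := d
    simp only [projC, mv', Fin.append_left] at *
    congr 1
    · funext i; exact (hpos i).symm
    · funext i; exact (hval i).symm
    · exact hq.symm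

/-- A long run visiting few configurations yields an infinite branch. -/
theorem long_run {p : ℕ} (M : NDPM p) (w : List Bool) (c) (n : ℕ)
    (f : ℕ → PConfig p M.Q) (h0 : f 0 = M.initConfig c)
    (hf : ∀ i, i < n → M.Step w (f i) (f (i + 1)))
    (hn : letI := M.finQ
      Fintype.card ((Fin p → Option Bool) × M.Q) * (w.length + 1) ^ p ≤ n) :
    M.InfiniteBranch c w := by
  letI := M.finQ
  have hle : ∀ i, i ≤ n → ∀ j, (f i).pos j < w.length + 1 := by
    intro i
    induction i with
    | zero => intro _ j; rw [h0]; simp [NDPM.initConfig]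
    | succ i ih =>
      intro hi j
      obtain ⟨mv, q', -, -, hpos, -⟩ := hf i hi
      rw [hpos]
      cases mv j
      · exact Nat.mod_lt _ (Nat.succ_pos _)
      · exact Nat.mod_lt _ (Nat.succ_pos _)
      · exact ih (by omega) j
  let g : Fin (n + 1) → ((Fin p → Option Bool) × M.Q) × (Fin p → Fin (w.length + 1)) :=
    fun i => (((f i).val, (f i).state), fun j => ⟨(f i).pos j, hle i (by omega) j⟩)
  have hcard : Fintype.card (((Fin p → Option Bool) × M.Q) × (Fin p → Fin (w.length + 1))) <
      Fintype.card (Fin (n + 1)) := by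
    rw [Fintype.card_prod, Fintype.card_fin, Fintype.card_fun, Fintype.card_fin, Fintype.card_fin]
    exact Nat.lt_succ_of_le hn
  obtain ⟨a, b, hab, hg⟩ := Fintype.exists_ne_map_eq_of_card_lt g hcard
  have hfe : ∀ a b : Fin (n + 1), g a = g b → f a = f b := by
    intro a b h
    simp only [g, Prod.mk.injEq] at h
    obtain ⟨⟨e1, e2⟩, e3⟩ := h
    have e4 : (f a).pos = (f b).pos := by
      funext j
      exact congrArg Fin.val (congrFun e3 j)
    cases hA : f a
    cases hB : f b
    simp_all
  obtain ⟨i, j, hij, hjn, hfij⟩ : ∃ i j, i < j ∧ j ≤ n ∧ f i = f j := by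
    rcases lt_or_gt_of_ne hab with h | h
    · exact ⟨a, b, h, by omega, hfe _ _ hg⟩
    · exact ⟨b, a, h, by omega, (hfe _ _ hg).symm⟩
  let s : ℕ → ℕ := fun m => Nat.rec 0 (fun _ x => if x + 1 = j then i else x + 1) m
  have hs1 : ∀ m, s (m + 1) = if s m + 1 = j then i else s m + 1 := fun m => rfl
  have hs : ∀ m, s m < j := by
    intro m
    induction m with
    | zero => exact lt_of_le_of_lt (Nat.zero_le i) hij
    | succ m ih => rw [hs1]; split_ifs <;> omega
  refine ⟨fun m => f (s m), h0, fun m => ?_⟩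
  have hst := hf (s m) (by have := hs m; omega)
  simp only [hs1]
  split_ifs with h
  · rw [h, ← hfij] at hst; exact hst
  · exact hst

/-- for every NDPM `M` and every set `S` of binary words decided by `M`,
there exists an acyclic NDPM `M'` (possibly with more pointers and more states) that
decides `S`. -/
theorem acyclic_normalization {p : ℕ} (M : NDPM p) (S : Set (List Bool))
    (h : M.Decides S) :
    ∃ (p' : ℕ) (M' : NDPM p'), M'.Acyclic ∧ M'.Decides S := by
  obtain ⟨c, hc⟩ := h
  letI := M.finQ
  let K := Fintype.card ((Fin p → Option Bool) × M.Q)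
  refine ⟨p + p, M.clocked K, clocked_acyclic M K, ?_⟩
  let c0 : (Fin (p + p) → Option Bool) × (M.clocked K).Q :=
    (Fin.append c.1 (fun _ => none), (c.2, Fin.last K))
  refine ⟨c0, fun w => ?_⟩
  rw [← hc w]
  have hproj : projC (K := K) ((M.clocked K).initConfig c0) = M.initConfig c := by
    simp [projC, NDPM.initConfig, c0]
  have htime : timeC (K := K) w.length ((M.clocked K).initConfig c0) = K * (w.length + 1) ^ p := by
    simp [timeC, NDPM.initConfig, c0, digC, -Fin.natAdd_eq_addNat]
  have hinv := init_inv M K w.length c0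
  have main : (M.clocked K).Rejects c0 w ↔ M.InfiniteBranch c w ∨ M.Rejects c w := by
    constructor
    · rintro ⟨d, hd, hr⟩
      have run : ∃ (n : ℕ) (f : ℕ → PConfig p M.Q), f 0 = M.initConfig c ∧
          f n = projC (K := K) d ∧ (∀ i, i < n → M.Step w (f i) (f (i + 1))) ∧
          invC (K := K) w.length d ∧
          timeC (K := K) w.length d + n = K * (w.length + 1) ^ p := by
        clear hr
        induction hd with
        | refl => exact ⟨0, fun _ => M.initConfig c, rfl, hproj.symm, by simp, hinv, htime⟩
        | @tail d e _ hs ih =>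
          obtain ⟨n, f, f0, fn, hf, hi, ht⟩ := ih
          obtain ⟨s1, s2, s3⟩ := step_inv M K w d e hs hi
          refine ⟨n + 1, fun i => if i ≤ n then f i else projC (K := K) e, by simpa using f0,
            by simp, ?_, s2, by omega⟩
          intro i hi
          rcases Nat.lt_or_ge i n with h | h
          · simp only [if_pos h.le, if_pos (Nat.succ_le_of_lt h)]
            exact hf i h
          · have : i = n := by omega
            subst this
            simpa [fn] using s1
      obtain ⟨n, f, f0, fn, hf, hi, ht⟩ := run
      rcases hr with hr | ⟨hz, ha⟩
      · right
        refine ⟨projC (K := K) d, ?_, hr⟩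
        rw [← f0, ← fn]
        clear fn ht
        induction n with
        | zero => exact Relation.ReflTransGen.refl
        | succ n ih =>
          exact (ih (fun i h => hf i (by omega))).tail (hf n (by omega))
      · left
        have t0 : timeC (K := K) w.length d = 0 := by
          simp only at ha hz
          simp [timeC, digC, ha, hz, -Fin.natAdd_eq_addNat]
        exact long_run M w c n f f0 hf (by
          rw [t0, Nat.zero_add] at ht
          exact ht.ge)
    · rintro (⟨f, f0, hf⟩ | ⟨d, hd, hr⟩)
      · by_contra hrej
        have H : ∀ n, ∃ d, Relation.ReflTransGen ((M.clocked K).Step w)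
            ((M.clocked K).initConfig c0) d ∧ projC (K := K) d = f n ∧
            invC (K := K) w.length d ∧
            timeC (K := K) w.length d + n = K * (w.length + 1) ^ p := by
          intro n
          induction n with
          | zero => exact ⟨_, Relation.ReflTransGen.refl, by rw [f0, hproj], hinv, htime⟩
          | succ n ih =>
            obtain ⟨d, hd, hp, hi, ht⟩ := ih
            rcases lift_step M K w d (f (n + 1)) (hp ▸ hf n) with h | ⟨e, he, hpe⟩
            · exact absurd ⟨d, hd, h⟩ hrej
            · obtain ⟨-, s2, s3⟩ := step_inv M K w d e he hi
              exact ⟨e, hd.tail he, hpe, s2, by omega⟩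
        obtain ⟨d, -, -, -, ht⟩ := H (K * (w.length + 1) ^ p + 1)
        omega
      · by_contra hrej
        have H : ∃ e, Relation.ReflTransGen ((M.clocked K).Step w)
            ((M.clocked K).initConfig c0) e ∧ projC (K := K) e = d := by
          clear hr
          induction hd with
          | refl => exact ⟨_, Relation.ReflTransGen.refl, hproj⟩
          | tail _ hs ih =>
            obtain ⟨e, he, hp⟩ := ih
            subst hp
            rcases lift_step M K w e _ hs with h | ⟨e', he', hpe⟩
            · exact absurd ⟨e, he, h⟩ hrej
            · exact ⟨e', he.tail he', hpe⟩
        obtain ⟨e, he, hp⟩ := H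
        subst hp
        exact hrej ⟨e, he, Or.inl hr⟩
  have hac := clocked_acyclic M K c0 w
  unfold NDPM.Accepts
  tauto
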